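/- arXiv:1911.00680 — 2 statements merged into one kernel-verified Lean document; each statement's English description precedes it below -/
import Mathlib

section
/- Let n : ℕ → ℕ with n(ℓ) ≥ 2 for all ℓ, let X = Π_{ℓ∈ℕ} Fin(n(ℓ)) be the path space with product measure μ, and let G be a finitely generated group acting minimally on X by tree automorphisms. Suppose every element of G acts as a locally non-degenerate tree automorphism and the action is locally quasi-analytic. Then there exists a subgroup H of G such that μ({x ∈ X : G_x is conjugate to H in G}) = 1. -/
open MeasureTheory ENNReal

/-- The cylinder set in the path space `Π k, Fin (n k)` determined by a finite word `w`
of length `ℓ`. -/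
def Cyl (n : ℕ → ℕ) {ℓ : ℕ} (w : (i : Fin ℓ) → Fin (n i)) : Set (∀ k : ℕ, Fin (n k)) :=
  {x | ∀ i : Fin ℓ, x i = w i}

/-- A tree automorphism of the path space: a bijection such that two paths agree in the
first `ℓ` coordinates iff their images do. -/
def IsTreeAut (n : ℕ → ℕ) (f : (∀ k : ℕ, Fin (n k)) → ∀ k : ℕ, Fin (n k)) : Prop :=
  Function.Bijective f ∧ ∀ (ℓ : ℕ) (x y : ∀ k : ℕ, Fin (n k)),
    (∀ i : Fin ℓ, x i = y i) ↔ (∀ i : Fin ℓ, f x i = f y i)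

/-- A tree automorphism is locally non-degenerate. -/
def LocNonDeg (n : ℕ → ℕ) (μ : Measure (∀ k : ℕ, Fin (n k)))
    (f : (∀ k : ℕ, Fin (n k)) → ∀ k : ℕ, Fin (n k)) : Prop :=
  ∃ α : ℝ≥0∞, 0 < α ∧ α ≤ 1 ∧ ∀ (ℓ : ℕ) (w : (i : Fin ℓ) → Fin (n i)),
    f '' Cyl n w = Cyl n w → (∃ u ∈ Cyl n w, f u ≠ u) →
      α * μ (Cyl n w) ≤ μ {u ∈ Cyl n w | f u ≠ u}

/-- The action is locally quasi-analytic (tree version): there is a level `L` such that for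
any word `w` of length `≥ L`, two group elements agreeing on a nonempty open subset of the
cylinder `C_w` agree on all of `C_w`. -/
def TreeLQA (n : ℕ → ℕ) (G : Type*) [Group G] [MulAction G (∀ k : ℕ, Fin (n k))] : Prop :=
  ∃ L : ℕ, ∀ ℓ : ℕ, L ≤ ℓ → ∀ (w : (i : Fin ℓ) → Fin (n i)) (g₁ g₂ : G),
    (∃ V : Set (∀ k : ℕ, Fin (n k)), IsOpen V ∧ V.Nonempty ∧ V ⊆ Cyl n w ∧
      ∀ v ∈ V, g₁ • v = g₂ • v) →
    ∀ u ∈ Cyl n w, g₁ • u = g₂ • u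

theorem cyl_eq_iInter (n : ℕ → ℕ) {ℓ : ℕ} (w : (i : Fin ℓ) → Fin (n i)) :
    Cyl n w = ⋂ i : Fin ℓ, (fun x : ∀ k : ℕ, Fin (n k) => x i) ⁻¹' {w i} := by
  ext x; simp [Cyl]

theorem isOpen_cyl (n : ℕ → ℕ) {ℓ : ℕ} (w : (i : Fin ℓ) → Fin (n i)) : IsOpen (Cyl n w) := by
  rw [cyl_eq_iInter]
  exact isOpen_iInter_of_finite fun i => (isOpen_discrete _).preimage (continuous_apply _)

theorem measurableSet_cyl (n : ℕ → ℕ) {ℓ : ℕ} (w : (i : Fin ℓ) → Fin (n i)) :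
    MeasurableSet (Cyl n w) := (isOpen_cyl n w).measurableSet

theorem mem_cyl_self (n : ℕ → ℕ) (ℓ : ℕ) (x : ∀ k : ℕ, Fin (n k)) :
    x ∈ Cyl n (fun i : Fin ℓ => x i) := fun _ => rfl

theorem cyl_eq_of_mem {n : ℕ → ℕ} {ℓ : ℕ} {w : (i : Fin ℓ) → Fin (n i)}
    {x : ∀ k : ℕ, Fin (n k)} (hx : x ∈ Cyl n w) : (fun i : Fin ℓ => x i) = w :=
  funext hx

theorem pairwise_disjoint_cyl (n : ℕ → ℕ) (ℓ : ℕ) :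
    Pairwise (Function.onFun Disjoint fun w : (i : Fin ℓ) → Fin (n i) => Cyl n w) := by
  intro w w' hne
  refine Set.disjoint_left.2 fun x hx hx' => hne ?_
  rw [← cyl_eq_of_mem hx, ← cyl_eq_of_mem hx']

/-- Cylinders around a point form a neighbourhood basis. -/
theorem exists_cyl_subset {n : ℕ → ℕ} {U : Set (∀ k : ℕ, Fin (n k))} (hU : IsOpen U)
    {x : ∀ k : ℕ, Fin (n k)} (hx : x ∈ U) :
    ∃ ℓ : ℕ, Cyl n (fun i : Fin ℓ => x i) ⊆ U := by
  obtain ⟨I, u, hu, hsub⟩ := isOpen_pi_iff.1 hU x hx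
  refine ⟨I.sup id + 1, fun y hy => hsub fun i hi => ?_⟩
  have hlt : i < I.sup id + 1 := Nat.lt_succ_of_le (Finset.le_sup (f := id) hi)
  have : y i = x i := hy ⟨i, hlt⟩
  rw [this]
  exact (hu i hi).2

theorem IsTreeAut.image_cyl {n : ℕ → ℕ} {f : (∀ k : ℕ, Fin (n k)) → ∀ k : ℕ, Fin (n k)}
    (hf : IsTreeAut n f) (ℓ : ℕ) (x : ∀ k : ℕ, Fin (n k)) :
    f '' Cyl n (fun i : Fin ℓ => x i) = Cyl n (fun i : Fin ℓ => f x i) := by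
  ext y
  constructor
  · rintro ⟨z, hz, rfl⟩
    exact (hf.2 ℓ z x).1 hz
  · intro hy
    obtain ⟨z, rfl⟩ := hf.1.2 y
    exact ⟨z, (hf.2 ℓ z x).2 hy, rfl⟩

theorem IsTreeAut.continuous {n : ℕ → ℕ} {f : (∀ k : ℕ, Fin (n k)) → ∀ k : ℕ, Fin (n k)}
    (hf : IsTreeAut n f) : Continuous f := by
  refine continuous_iff_continuousAt.2 fun x U hU => ?_
  obtain ⟨V, hVU, hV, hxV⟩ := mem_nhds_iff.1 hU
  obtain ⟨ℓ, hℓ⟩ := exists_cyl_subset hV hxV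
  refine Filter.mem_map.2 (Filter.mem_of_superset ((isOpen_cyl n _).mem_nhds (mem_cyl_self n ℓ x)) fun y hy => ?_)
  exact hVU (hℓ (by rw [← hf.image_cyl]; exact ⟨y, hy, rfl⟩))

/-- A closed set `B` is null if, relative to each cylinder meeting it, a fixed proportion of the
cylinder lies in a set disjoint from `B`. -/
theorem measure_eq_zero_of_cyl_proportion {n : ℕ → ℕ} {μ : Measure (∀ k : ℕ, Fin (n k))}
    [IsFiniteMeasure μ] {B M : Set (∀ k : ℕ, Fin (n k))} (hB : IsClosed B)
    (hM : MeasurableSet M) (hBM : Disjoint B M) {α : ℝ≥0∞} (hα : α ≠ 0)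
    (h : ∀ (ℓ : ℕ), ∀ x ∈ B, α * μ (Cyl n (fun i : Fin ℓ => x i)) ≤
      μ (Cyl n (fun i : Fin ℓ => x i) ∩ M)) : μ B = 0 := by
  let S : (ℓ : ℕ) → Set ((i : Fin ℓ) → Fin (n i)) := fun ℓ => (fun x i => x i) '' B
  let U : ℕ → Set (∀ k : ℕ, Fin (n k)) := fun ℓ => ⋃ w ∈ S ℓ, Cyl n w
  have memU : ∀ ℓ y, y ∈ U ℓ ↔ ∃ x ∈ B, y ∈ Cyl n (fun i : Fin ℓ => x i) := by
    intro ℓ y; simp [U, S]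
  have hBU : ∀ ℓ, B ⊆ U ℓ := fun ℓ x hx => (memU ℓ x).2 ⟨x, hx, mem_cyl_self n ℓ x⟩
  have hUm : ∀ ℓ, MeasurableSet (U ℓ) := fun ℓ =>
    MeasurableSet.biUnion (Set.to_countable _) fun w _ => measurableSet_cyl n w
  have hanti : Antitone U := by
    intro a b hab y hy
    obtain ⟨x, hx, hyx⟩ := (memU b y).1 hy
    exact (memU a y).2 ⟨x, hx, fun i => hyx ⟨i, i.2.trans_le hab⟩⟩
  have hInter : ⋂ ℓ, U ℓ = B := by
    refine Set.Subset.antisymm (fun y hy => ?_) (Set.subset_iInter hBU)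
    by_contra hyB
    obtain ⟨ℓ, hℓ⟩ := exists_cyl_subset hB.isOpen_compl hyB
    obtain ⟨x, hx, hyx⟩ := (memU ℓ y).1 (Set.mem_iInter.1 hy ℓ)
    exact hℓ (fun i => (hyx i).symm) hx
  have hlim : Filter.Tendsto (fun ℓ => μ (U ℓ)) Filter.atTop (nhds (μ B)) := by
    have := tendsto_measure_iInter_atTop (μ := μ) (fun ℓ => (hUm ℓ).nullMeasurableSet) hanti
      ⟨0, measure_ne_top _ _⟩
    rwa [hInter] at this
  have hprop : ∀ ℓ, α * μ (U ℓ) ≤ μ (U ℓ ∩ M) := by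
    intro ℓ
    have hdisj : (S ℓ).PairwiseDisjoint fun w => Cyl n w :=
      (pairwise_disjoint_cyl n ℓ).set_pairwise _
    simp only [U]
    rw [Set.iUnion₂_inter, measure_biUnion (Set.to_countable _) hdisj
        fun w _ => measurableSet_cyl n w,
      measure_biUnion (Set.to_countable _)
        (hdisj.mono fun w => Set.inter_subset_left)
        fun w _ => (measurableSet_cyl n w).inter hM, ← ENNReal.tsum_mul_left]
    refine ENNReal.tsum_le_tsum ?_
    rintro ⟨_, x, hx, rfl⟩
    exact h ℓ x hx
  have hle : ∀ ℓ, α * μ B + μ B ≤ μ (U ℓ) := by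
    intro ℓ
    calc α * μ B + μ B ≤ μ (U ℓ ∩ M) + μ (U ℓ \ M) :=
          add_le_add ((mul_le_mul_right (measure_mono (hBU ℓ)) α).trans (hprop ℓ))
            (measure_mono fun x hx => ⟨hBU ℓ hx, Set.disjoint_left.1 hBM hx⟩)
      _ = μ (U ℓ) := measure_inter_add_sdiff _ hM
  have hfin : α * μ B + μ B ≤ 0 + μ B := by
    rw [zero_add]
    exact ge_of_tendsto' hlim hle
  have := (ENNReal.add_le_add_iff_right (measure_ne_top μ B)).1 hfin
  exact (mul_eq_zero.1 (nonpos_iff_eq_zero.1 this)).resolve_left hα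

/-- Almost every fixed point of a locally non-degenerate tree automorphism is interior to the
fixed point set. -/
theorem LocNonDeg.ae_mem_interior {n : ℕ → ℕ} {μ : Measure (∀ k : ℕ, Fin (n k))}
    [IsFiniteMeasure μ] {f : (∀ k : ℕ, Fin (n k)) → ∀ k : ℕ, Fin (n k)}
    (hnd : LocNonDeg n μ f) (hf : IsTreeAut n f) :
    ∀ᵐ x ∂μ, f x = x → x ∈ interior {y | f y = y} := by
  obtain ⟨α, hα, -, h⟩ := hnd
  have hclosed : IsClosed {y | f y = y} := isClosed_eq hf.continuous continuous_id
  have hnull : μ ({y | f y = y} \ interior {y | f y = y}) = 0 := by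
    refine measure_eq_zero_of_cyl_proportion (M := {y | f y = y}ᶜ)
      (hclosed.sdiff isOpen_interior) hclosed.measurableSet.compl
      (Set.disjoint_left.2 fun x hx hx' => hx' hx.1) hα.ne' fun ℓ x hx => ?_
    refine h ℓ _ ?_ ?_
    · rw [hf.image_cyl, show f x = x from hx.1]
    · by_contra! hcon
      exact hx.2 (mem_interior.2 ⟨_, hcon, isOpen_cyl n _, mem_cyl_self n ℓ x⟩)
  refine measure_mono_null (fun x hx => ?_) hnull
  simpa using hx

/-- If a finitely generated group acts minimally on the path space by locally
non-degenerate tree automorphisms and the action is locally quasi-analytic, then there is a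
subgroup `H` of `G` such that the set of points whose stabilizer is conjugate to `H` has
full measure. -/
theorem statement8 (n : ℕ → ℕ) (hn : ∀ ℓ : ℕ, 2 ≤ n ℓ)
    (μ : Measure (∀ k : ℕ, Fin (n k))) [IsProbabilityMeasure μ]
    (hμ : ∀ (ℓ : ℕ) (w : (i : Fin ℓ) → Fin (n i)),
      μ (Cyl n w) = ∏ i : Fin ℓ, ((n i : ℝ≥0∞))⁻¹)
    {G : Type*} [Group G] (hfg : Group.FG G) [MulAction G (∀ k : ℕ, Fin (n k))]
    (htree : ∀ g : G, IsTreeAut n (fun x => g • x))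
    (hmin : ∀ x : ∀ k : ℕ, Fin (n k), Dense (MulAction.orbit G x))
    (hnd : ∀ g : G, LocNonDeg n μ (fun x => g • x))
    (hlqa : TreeLQA n G) :
    ∃ H : Subgroup G,
      μ {x : ∀ k : ℕ, Fin (n k) |
          ∃ g : G, Subgroup.map (MulAut.conj g).toMonoidHom H = MulAction.stabilizer G x}
        = 1 := by
  have : Countable G := by
    obtain ⟨S, _, φ, hφ⟩ := Group.fg_iff_exists_freeGroup_hom_surjective_finite.1 hfg
    have : Countable (FreeGroup S) := Quot.mk_surjective.countable
    exact hφ.countable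
  obtain ⟨L, hL⟩ := hlqa
  let x₀ : ∀ k : ℕ, Fin (n k) := fun k => ⟨0, by have := hn k; omega⟩
  refine ⟨fixingSubgroup G (Cyl n (fun i : Fin L => x₀ i)), ?_⟩
  have hae : ∀ᵐ x ∂μ, ∀ g : G, g • x = x → x ∈ interior {y | g • y = y} :=
    ae_all_iff.2 fun g => (hnd g).ae_mem_interior (htree g)
  rw [← measure_univ (μ := μ)]
  refine measure_congr (Filter.eventuallyEq_univ.2 (hae.mono fun x hx => ?_))
  have hmem : ∀ k : G, k ∈ MulAction.stabilizer G x ↔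
      ∀ u ∈ Cyl n (fun i : Fin L => x i), k • u = u := by
    refine fun k => ⟨fun hk u hu => ?_, fun h => h x (mem_cyl_self n L x)⟩
    have := hL L le_rfl (fun i => x i) k 1 ⟨interior {y | k • y = y} ∩ Cyl n _,
      isOpen_interior.inter (isOpen_cyl n _), ⟨x, hx k hk, mem_cyl_self n L x⟩,
      Set.inter_subset_right, fun v hv => by
        rw [one_smul]; exact (interior_subset hv.1 : v ∈ {y | k • y = y})⟩ u hu
    rwa [one_smul] at this
  obtain ⟨_, hgx, g, rfl⟩ :=
    (hmin x₀).inter_open_nonempty _ (isOpen_cyl n _) ⟨x, mem_cyl_self n L x⟩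
  have himg : (fun y => g • y) '' Cyl n (fun i : Fin L => x₀ i) =
      Cyl n (fun i : Fin L => x i) := by
    rw [(htree g).image_cyl]
    exact congrArg (Cyl n) (cyl_eq_of_mem hgx)
  refine ⟨g, ?_⟩
  ext k
  rw [hmem, ← himg, Set.forall_mem_image, Subgroup.mem_map_equiv, mem_fixingSubgroup_iff]
  refine forall₂_congr fun u _ => ?_
  rw [MulAut.conj_symm_apply, mul_smul, mul_smul, inv_smul_eq_iff]
end

section
/- Let d ≥ 2, let X = ℕ → Fin(d) with the product topology and the uniform product (Bernoulli) measure μ, and let G be a group acting on X by tree automorphisms such that: (i) for every ℓ, G acts transitively on the set of words of length ℓ (equivalently on the level-ℓ cylinders), and (ii) every g ∈ G has a finite set of sections {g|_w : w a finite word}. Then the set {x ∈ X : g·x = x for some g ≠ 1} is meager in X if and only if it has μ-measure zero; that is, the action is topologically free if and only if it is essentially free. -/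
open MeasureTheory ENNReal

/-- The cylinder in `ℕ → Fin d` determined by a finite word `w : List (Fin d)`. -/
def CylL (d : ℕ) (w : List (Fin d)) : Set (ℕ → Fin d) :=
  {x | ∀ (k : ℕ) (h : k < w.length), x k = w.get ⟨k, h⟩}

/-- Concatenation of a finite word with an infinite sequence. -/
def concatW (d : ℕ) (w : List (Fin d)) (s : ℕ → Fin d) : ℕ → Fin d :=
  fun k => if h : k < w.length then w.get ⟨k, h⟩ else s (k - w.length)

/-- A tree automorphism of `ℕ → Fin d`: a bijection such that two sequences agree in the
first `ℓ` coordinates iff their images do. -/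
def IsTreeAutD (d : ℕ) (f : (ℕ → Fin d) → ℕ → Fin d) : Prop :=
  Function.Bijective f ∧ ∀ (ℓ : ℕ) (x y : ℕ → Fin d),
    (∀ k < ℓ, x k = y k) ↔ (∀ k < ℓ, f x k = f y k)

/-- `h` is the section of `f` at the word `w`: there is a word `w'` of the same length with
`f (w · s) = w' · (h s)` for all sequences `s`. -/
def IsSectionAt (d : ℕ) (f : (ℕ → Fin d) → ℕ → Fin d) (w : List (Fin d))
    (h : (ℕ → Fin d) → ℕ → Fin d) : Prop :=
  ∃ w' : List (Fin d), w'.length = w.length ∧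
    ∀ s : ℕ → Fin d, f (concatW d w s) = concatW d w' (h s)

theorem concatW_of_lt {d : ℕ} {w : List (Fin d)} {s : ℕ → Fin d} {k : ℕ} (h : k < w.length) :
    concatW d w s k = w[k] := by
  simp [concatW, h]

theorem concatW_of_le {d : ℕ} {w : List (Fin d)} {s : ℕ → Fin d} {k : ℕ} (h : w.length ≤ k) :
    concatW d w s k = s (k - w.length) := by
  simp [concatW, h]

theorem concatW_append {d : ℕ} (u v : List (Fin d)) (s : ℕ → Fin d) :
    concatW d (u ++ v) s = concatW d u (concatW d v s) := by
  funext k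
  rcases lt_or_ge k u.length with h | h
  · rw [concatW_of_lt (by simp; omega), concatW_of_lt h, List.getElem_append_left h]
  · rw [concatW_of_le h]
    rcases lt_or_ge (k - u.length) v.length with h' | h'
    · rw [concatW_of_lt (by simp; omega), concatW_of_lt h', List.getElem_append_right h]
    · rw [concatW_of_le (by simp; omega), concatW_of_le h', List.length_append, Nat.sub_add_eq]

theorem concatW_nil {d : ℕ} (s : ℕ → Fin d) : concatW d [] s = s := by
  funext k
  simp [concatW]

theorem concatW_head_tail {d : ℕ} (s : ℕ → Fin d) :
    concatW d [s 0] (fun k => s (k + 1)) = s := by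
  funext k
  cases k <;> simp [concatW]

theorem concatW_mem_cylL {d : ℕ} (w : List (Fin d)) (s : ℕ → Fin d) :
    concatW d w s ∈ CylL d w :=
  fun _ h => concatW_of_lt h

theorem concatW_drop {d : ℕ} {w : List (Fin d)} {x : ℕ → Fin d} (hx : x ∈ CylL d w) :
    concatW d w (fun k => x (w.length + k)) = x := by
  funext k
  rcases lt_or_ge k w.length with h | h
  · rw [concatW_of_lt h]
    exact (hx k h).symm
  · rw [concatW_of_le h, Nat.add_sub_cancel' h]

theorem concatW_mem_cylL_append {d : ℕ} {w u : List (Fin d)} {s : ℕ → Fin d} :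
    concatW d w s ∈ CylL d (w ++ u) ↔ s ∈ CylL d u := by
  constructor
  · intro h k hk
    have := h (w.length + k) (by simp; omega)
    simpa [concatW_of_le] using this
  · intro h
    rw [← concatW_drop h, ← concatW_append]
    exact concatW_mem_cylL _ _

theorem cylL_append_subset {d : ℕ} (w u : List (Fin d)) : CylL d (w ++ u) ⊆ CylL d w := by
  intro x hx k hk
  have := hx k (by simp; omega)
  simpa [List.getElem_append_left hk] using this

theorem cylL_ofFn {d : ℕ} (x : ℕ → Fin d) (n : ℕ) :
    CylL d (List.ofFn fun i : Fin n => x i) = PiNat.cylinder x n := by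
  ext y
  simp [CylL, PiNat.cylinder]

/-- If `f` is a tree automorphism and `h` a section of `f`, the first `ℓ` letters of `h s` only
depend on the first `ℓ` letters of `s`. -/
theorem IsSectionAt.agree {d : ℕ} {f h : (ℕ → Fin d) → ℕ → Fin d} {w : List (Fin d)}
    (hf : IsTreeAutD d f) (hs : IsSectionAt d f w h) {ℓ : ℕ} {x y : ℕ → Fin d}
    (hxy : ∀ k < ℓ, x k = y k) : ∀ k < ℓ, h x k = h y k := by
  obtain ⟨w', hw', H⟩ := hs
  have key := (hf.2 (w.length + ℓ) (concatW d w x) (concatW d w y)).1 fun k hk => by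
    rcases lt_or_ge k w.length with h | h
    · rw [concatW_of_lt h, concatW_of_lt h]
    · rw [concatW_of_le h, concatW_of_le h]
      exact hxy _ (by omega)
  intro k hk
  have := key (w.length + k) (by omega)
  rw [H, H, concatW_of_le (by omega), concatW_of_le (by omega)] at this
  simpa [hw'] using this

theorem isSectionAt_nil {d : ℕ} (f : (ℕ → Fin d) → ℕ → Fin d) : IsSectionAt d f [] f :=
  ⟨[], rfl, fun s => by rw [concatW_nil, concatW_nil]⟩

/-- Taking a one-letter section of a section yields a section. -/
theorem IsSectionAt.exists_step {d : ℕ} {f h : (ℕ → Fin d) → ℕ → Fin d} {w : List (Fin d)}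
    (hf : IsTreeAutD d f) (hs : IsSectionAt d f w h) (a : Fin d) :
    ∃ (b : Fin d) (h' : (ℕ → Fin d) → ℕ → Fin d), IsSectionAt d f (w ++ [a]) h' ∧
      ∀ s, h (concatW d [a] s) = concatW d [b] (h' s) := by
  have key : ∀ s, h (concatW d [a] s) = concatW d [h (concatW d [a] fun _ => a) 0]
      (fun k => h (concatW d [a] s) (k + 1)) := fun s => by
    have : h (concatW d [a] fun _ => a) 0 = h (concatW d [a] s) 0 :=
      hs.agree hf (ℓ := 1) (fun k hk => by
        rw [concatW_of_lt (by simpa using hk), concatW_of_lt (by simpa using hk)]) 0 one_pos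
    rw [this, concatW_head_tail]
  refine ⟨_, fun s k => h (concatW d [a] s) (k + 1), ?_, key⟩
  obtain ⟨w', hw', H⟩ := hs
  refine ⟨w' ++ [h (concatW d [a] fun _ => a) 0], by simp [hw'], fun s => ?_⟩
  rw [concatW_append, H, key, ← concatW_append]

/-- The transformation of infinite sequences computed by a Mealy machine with
transition-output function `δ` started in state `q`. -/
def mealyRun {d : ℕ} {Q : Type*} (δ : Q → Fin d → Fin d × Q) : Q → (ℕ → Fin d) → ℕ → Fin d
  | q, x, 0 => (δ q (x 0)).1
  | q, x, k + 1 => mealyRun δ (δ q (x 0)).2 (fun i => x (i + 1)) k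

theorem eq_mealyRun {d : ℕ} {Q : Type*} (δ : Q → Fin d → Fin d × Q)
    (st : Q → (ℕ → Fin d) → ℕ → Fin d)
    (hst : ∀ q a s, st q (concatW d [a] s) = concatW d [(δ q a).1] (st (δ q a).2 s)) (q : Q) :
    st q = mealyRun δ q := by
  funext x k
  induction k generalizing q x with
  | zero =>
    rw [← concatW_head_tail x, hst]
    simp [mealyRun, concatW]
  | succ k ih =>
    conv_lhs => rw [← concatW_head_tail x, hst]
    simp [mealyRun, concatW, ih]

/-- There are only countably many finite-state tree automorphisms. -/
theorem countable_finite_sections (d : ℕ) :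
    {f : (ℕ → Fin d) → ℕ → Fin d |
      IsTreeAutD d f ∧ {h | ∃ w, IsSectionAt d f w h}.Finite}.Countable := by
  refine (Set.countable_range
    (fun p : Σ n : ℕ, (Fin n → Fin d → Fin d × Fin n) × Fin n =>
      mealyRun p.2.1 p.2.2)).mono ?_
  rintro f ⟨hf, hfin⟩
  obtain ⟨n, st, -, hst⟩ := hfin.fin_param
  have step : ∀ q a, ∃ p : Fin d × Fin n, ∀ s,
      st q (concatW d [a] s) = concatW d [p.1] (st p.2 s) := fun q a => by
    obtain ⟨w, hw⟩ : st q ∈ {h | ∃ w, IsSectionAt d f w h} := hst ▸ Set.mem_range_self q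
    obtain ⟨b, h', hh', H⟩ := hw.exists_step hf a
    obtain ⟨q', rfl⟩ : h' ∈ Set.range st := hst ▸ ⟨_, hh'⟩
    exact ⟨(b, q'), H⟩
  choose δ hδ using step
  obtain ⟨q, rfl⟩ : f ∈ Set.range st := hst ▸ ⟨[], isSectionAt_nil f⟩
  exact ⟨⟨n, δ, q⟩, (eq_mealyRun δ st hδ q).symm⟩

theorem IsTreeAutD.isClosed_fixedPoints {d : ℕ} {f : (ℕ → Fin d) → ℕ → Fin d}
    (hf : IsTreeAutD d f) : IsClosed {x | f x = x} := by
  rw [← isOpen_compl_iff, isOpen_iff_mem_nhds]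
  intro x hx
  obtain ⟨k, hk⟩ := Function.ne_iff.1 hx
  refine Filter.mem_of_superset
    ((PiNat.isOpen_cylinder _ x (k + 1)).mem_nhds (PiNat.self_mem_cylinder x (k + 1))) ?_
  intro y hy hfy
  apply hk
  have hxy : ∀ i < k + 1, x i = y i := fun i hi => (hy i hi).symm
  rw [(hf.2 (k + 1) x y).1 hxy k k.lt_succ_self, hxy k k.lt_succ_self]
  exact congrFun hfy k

theorem exists_cylL_subset_of_interior_nonempty {d : ℕ} {A : Set (ℕ → Fin d)}
    (hA : (interior A).Nonempty) : ∃ w, CylL d w ⊆ A := by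
  obtain ⟨x, hx⟩ := hA
  obtain ⟨_, ⟨y, n, rfl⟩, -, hn⟩ :=
    (PiNat.isTopologicalBasis_cylinders fun _ : ℕ => Fin d).exists_subset_of_mem_open hx
      isOpen_interior
  exact ⟨List.ofFn fun i : Fin n => y i, cylL_ofFn y n ▸ hn.trans interior_subset⟩

theorem isOpen_cylL (d : ℕ) (w : List (Fin d)) : IsOpen (CylL d w) := by
  rw [isOpen_iff_mem_nhds]
  intro x hx
  refine Filter.mem_of_superset ((PiNat.isOpen_cylinder _ x w.length).mem_nhds
    (PiNat.self_mem_cylinder x w.length)) fun y hy k hk => ?_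
  rw [hy k hk, hx k hk]

/-- A nontrivial section of a tree automorphism moves some cylinder of every large level. -/
theorem IsSectionAt.eventually_exists_moved {d : ℕ} {f h : (ℕ → Fin d) → ℕ → Fin d}
    {w : List (Fin d)} (hf : IsTreeAutD d f) (hs : IsSectionAt d f w h) (hne : h ≠ id) :
    ∀ᶠ N in Filter.atTop, ∃ u : Fin N → Fin d, ∀ s ∈ CylL d (List.ofFn u), h s ≠ s := by
  obtain ⟨s, hsne⟩ := Function.ne_iff.1 hne
  obtain ⟨k, hk⟩ := Function.ne_iff.1 hsne
  filter_upwards [Filter.eventually_gt_atTop k] with N hN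
  refine ⟨fun i => s i, fun t ht hfix => hk ?_⟩
  rw [cylL_ofFn] at ht
  rw [← hs.agree hf ht k hN, hfix, ht k hN, id]

/-- If a finite-state tree automorphism fixes no cylinder pointwise, then for some `N` every
cylinder `C_w` contains a cylinder `N` levels deeper without fixed points. -/
theorem IsTreeAutD.exists_uniform_moved {d : ℕ} {f : (ℕ → Fin d) → ℕ → Fin d}
    (hf : IsTreeAutD d f) (hfin : {h | ∃ w, IsSectionAt d f w h}.Finite)
    (hfix : ∀ w, ¬ CylL d w ⊆ {x | f x = x}) :
    ∃ N : ℕ, ∀ w, ∃ u : Fin N → Fin d,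
      {x | f x = x} ∩ CylL d (w ++ List.ofFn u) = ∅ := by
  have hev : ∀ᶠ N in Filter.atTop, ∀ h ∈ {h | ∃ w, IsSectionAt d f w h}, h ≠ id →
      ∃ u : Fin N → Fin d, ∀ s ∈ CylL d (List.ofFn u), h s ≠ s := by
    rw [Filter.eventually_all_finite hfin]
    rintro h ⟨w, hw⟩
    by_cases hne : h = id
    · simp [hne]
    · filter_upwards [hw.eventually_exists_moved hf hne] with N hN _ using hN
  obtain ⟨N, hN⟩ := hev.exists
  refine ⟨N, fun w => ?_⟩
  obtain ⟨y, -, -⟩ := Set.not_subset.1 (hfix [])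
  rcases ({x | f x = x} ∩ CylL d w).eq_empty_or_nonempty with he | ⟨x, hx, hxw⟩
  · refine ⟨fun i => y i, Set.subset_empty_iff.1 (he ▸ ?_)⟩
    exact Set.inter_subset_inter_right _ (cylL_append_subset _ _)
  have hmem : ∀ s, f (concatW d w s) ∈ CylL d w := fun s k hk => by
    have hx' : f x = x := hx
    rw [← (hf.2 w.length x (concatW d w s)).1
      (fun k hk => (hxw k hk).trans (concatW_of_lt hk).symm) k hk, hx', hxw k hk]
  set h : (ℕ → Fin d) → ℕ → Fin d := fun s k => f (concatW d w s) (w.length + k) with hdef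
  have hh : ∀ s, f (concatW d w s) = concatW d w (h s) := fun s => (concatW_drop (hmem s)).symm
  obtain ⟨u, hu⟩ := hN h ⟨w, w, rfl, hh⟩ fun hid => hfix w fun z hz => by
    have := hh fun k => z (w.length + k)
    rwa [hid, id, concatW_drop hz] at this
  refine ⟨u, Set.eq_empty_iff_forall_notMem.2 ?_⟩
  rintro z ⟨hz, hzu⟩
  have hzw := concatW_drop (cylL_append_subset _ _ hzu)
  refine hu (fun k => z (w.length + k)) (concatW_mem_cylL_append.1 (hzw.symm ▸ hzu)) ?_
  funext k
  have hz' : f z = z := hz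
  simp [hdef, hzw, hz']

theorem cylL_subset_iUnion_append {d : ℕ} (w : List (Fin d)) (N : ℕ) :
    CylL d w ⊆ ⋃ v : Fin N → Fin d, CylL d (w ++ List.ofFn v) := by
  intro x hx
  refine Set.mem_iUnion.2 ⟨fun i => x (w.length + i), ?_⟩
  rw [← concatW_drop hx, concatW_mem_cylL_append, concatW_drop hx,
    cylL_ofFn fun k => x (w.length + k)]
  exact PiNat.self_mem_cylinder _ _

/-- A set which misses, inside each cylinder, a cylinder `N` levels deeper is null for the
uniform Bernoulli measure. -/
theorem measure_eq_zero_of_uniformly_porous {d : ℕ} (hd : d ≠ 0) {μ : Measure (ℕ → Fin d)}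
    (hμ : ∀ w : List (Fin d), μ (CylL d w) = ((d : ℝ≥0∞))⁻¹ ^ w.length)
    {F : Set (ℕ → Fin d)} {N : ℕ}
    (hF : ∀ w, ∃ u : Fin N → Fin d, F ∩ CylL d (w ++ List.ofFn u) = ∅) : μ F = 0 := by
  set r : ℝ≥0∞ := ((d ^ N - 1 : ℕ) : ℝ≥0∞) * (d : ℝ≥0∞)⁻¹ ^ N with hr
  have hbound : ∀ (k : ℕ) (w : List (Fin d)),
      μ (F ∩ CylL d w) ≤ r ^ k * (d : ℝ≥0∞)⁻¹ ^ w.length := by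
    intro k
    induction k with
    | zero =>
      intro w
      rw [pow_zero, one_mul, ← hμ]
      exact measure_mono Set.inter_subset_right
    | succ k ih =>
      intro w
      obtain ⟨u, hu⟩ := hF w
      have hsub : F ∩ CylL d w ⊆
          ⋃ v ∈ Finset.univ.erase u, F ∩ CylL d (w ++ List.ofFn v) := by
        rintro x ⟨hxF, hxw⟩
        obtain ⟨v, hv⟩ := Set.mem_iUnion.1 (cylL_subset_iUnion_append w N hxw)
        refine Set.mem_iUnion₂.2 ⟨v, Finset.mem_erase.2 ⟨?_, Finset.mem_univ v⟩, hxF, hv⟩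
        rintro rfl
        exact Set.notMem_empty x (hu ▸ ⟨hxF, hv⟩)
      calc μ (F ∩ CylL d w)
          ≤ ∑ v ∈ Finset.univ.erase u, μ (F ∩ CylL d (w ++ List.ofFn v)) :=
            (measure_mono hsub).trans (measure_biUnion_finset_le _ _)
        _ ≤ ∑ _v ∈ Finset.univ.erase u, r ^ k * (d : ℝ≥0∞)⁻¹ ^ (w.length + N) :=
            Finset.sum_le_sum fun v _ => by simpa using ih (w ++ List.ofFn v)
        _ = r ^ (k + 1) * (d : ℝ≥0∞)⁻¹ ^ w.length := by
            rw [Finset.sum_const, Finset.card_erase_of_mem (Finset.mem_univ u), Finset.card_univ,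
              Fintype.card_fun, Fintype.card_fin, Fintype.card_fin, nsmul_eq_mul, pow_succ r,
              pow_add]
            conv_rhs => rw [hr]
            ring
  have hr1 : r < 1 := by
    have hpos : 0 < d ^ N := pow_pos (Nat.pos_of_ne_zero hd) N
    rw [hr, ← ENNReal.inv_pow, ← div_eq_mul_inv]
    refine ENNReal.div_lt_of_lt_mul ?_
    rw [one_mul]
    exact_mod_cast Nat.sub_lt hpos one_pos
  refine le_antisymm (ge_of_tendsto' (ENNReal.tendsto_pow_atTop_nhds_zero_of_lt_one hr1)
    fun k => ?_) bot_le
  have h := hbound k []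
  have hnil : CylL d [] = Set.univ := by
    ext x
    simp [CylL]
  simpa [hnil] using h

/-- The fixed point set of a finite-state tree automorphism is null if and only if it is
meagre. -/
theorem IsTreeAutD.measure_fixedPoints_eq_zero_iff {d : ℕ} (hd : d ≠ 0)
    {μ : Measure (ℕ → Fin d)}
    (hμ : ∀ w : List (Fin d), μ (CylL d w) = ((d : ℝ≥0∞))⁻¹ ^ w.length)
    {f : (ℕ → Fin d) → ℕ → Fin d}
    (hf : IsTreeAutD d f) (hfin : {h | ∃ w, IsSectionAt d f w h}.Finite) :
    μ {x | f x = x} = 0 ↔ IsMeagre {x | f x = x} := by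
  constructor
  · intro h0
    refine IsNowhereDense.isMeagre (hf.isClosed_fixedPoints.isNowhereDense_iff.2 ?_)
    by_contra hne
    obtain ⟨w, hw⟩ := exists_cylL_subset_of_interior_nonempty (Set.nonempty_iff_ne_empty.2 hne)
    have := measure_mono_null hw h0
    rw [hμ] at this
    simp at this
  · intro hm
    obtain ⟨N, hN⟩ := hf.exists_uniform_moved hfin fun w hw =>
      not_isMeagre_of_isOpen (isOpen_cylL d w)
        ⟨_, concatW_mem_cylL w fun _ => ⟨0, Nat.pos_of_ne_zero hd⟩⟩ (hm.mono hw)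
    exact measure_eq_zero_of_uniformly_porous hd hμ hN

/-- For a group acting on the `d`-ary path space by tree automorphisms,
level-transitively, with every element having finitely many sections (finite automata),
the action is topologically free iff it is essentially free. -/
theorem statement11 (d : ℕ) (hd : 2 ≤ d)
    (μ : Measure (ℕ → Fin d)) [IsProbabilityMeasure μ]
    (hμ : ∀ w : List (Fin d), μ (CylL d w) = ((d : ℝ≥0∞))⁻¹ ^ w.length)
    {G : Type*} [Group G] [MulAction G (ℕ → Fin d)]
    (htree : ∀ g : G, IsTreeAutD d (fun x => g • x))
    (htrans : ∀ w w' : List (Fin d), w.length = w'.length →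
      ∃ g : G, (fun x : ℕ → Fin d => g • x) '' CylL d w = CylL d w')
    (hfin : ∀ g : G,
      ({h : (ℕ → Fin d) → ℕ → Fin d |
        ∃ w : List (Fin d), IsSectionAt d (fun x => g • x) w h}).Finite) :
    IsMeagre {x : ℕ → Fin d | ∃ g : G, g ≠ 1 ∧ g • x = x} ↔
      μ {x : ℕ → Fin d | ∃ g : G, g ≠ 1 ∧ g • x = x} = 0 := by
  set T : Set ((ℕ → Fin d) → ℕ → Fin d) := {f | ∃ g : G, g ≠ 1 ∧ (fun x => g • x) = f} with hT
  have hTA : ∀ f ∈ T, IsTreeAutD d f ∧ {h | ∃ w, IsSectionAt d f w h}.Finite := by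
    rintro _ ⟨g, -, rfl⟩
    exact ⟨htree g, hfin g⟩
  have hTc : T.Countable := (countable_finite_sections d).mono hTA
  have hU : {x : ℕ → Fin d | ∃ g : G, g ≠ 1 ∧ g • x = x} = ⋃ f ∈ T, {x | f x = x} := by
    ext x
    simp [hT]
  have hiff : ∀ f ∈ T, (μ {x | f x = x} = 0 ↔ IsMeagre {x | f x = x}) := fun f hf =>
    (hTA f hf).1.measure_fixedPoints_eq_zero_iff (by omega) hμ (hTA f hf).2
  rw [hU, measure_biUnion_null_iff hTc]
  constructor
  · exact fun h f hf => (hiff f hf).2 (h.mono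
      (Set.subset_biUnion_of_mem (u := fun f => {x | f x = x}) hf))
  · exact fun h => isMeagre_biUnion hTc fun f hf => (hiff f hf).1 (h f hf)
end
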